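/- Let J ≥ 1, let a_1,…,a_{J+1} be positive integers, and let s_1,…,s_J be positive integers with s_j ≤ a_j·a_{j+1} for each j, and set s_tot = Σ_{j=1}^J s_j. Define D = {D_J⋯D_2D_1 : D_j ∈ ℝ^{a_{j+1}×a_j}, ‖D_j‖_0 ≤ s_j, ‖D_j‖_F = 1 for all j}. Then there exists a constant C > 0 such that for every ε ∈ (0,1] the set D admits an ε-net (with respect to the Frobenius metric) of cardinality at most (C/ε)^{s_tot}. Consequently, the upper box-counting (covering) dimension of D, namely limsup_{ε→0} log N(D,ε)/log(1/ε), is at most s_tot. -/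

import Mathlib

noncomputable def frobNorm {p q : ℕ} (A : Matrix (Fin p) (Fin q) ℝ) : ℝ :=
  Real.sqrt (∑ i, ∑ j, A i j ^ 2)

open Classical in
noncomputable def l0 {p q : ℕ} (A : Matrix (Fin p) (Fin q) ℝ) : ℕ :=
  (Finset.univ.filter fun ij : Fin p × Fin q => A ij.1 ij.2 ≠ 0).card

/-- `chainProd a J D = D (J-1) * ⋯ * D 1 * D 0`, the product of the first `J`
matrices of the chain `D`, where `D j` has size `a (j+1) × a j`. -/
noncomputable def chainProd (a : ℕ → ℕ) :
    (J : ℕ) → (∀ j : ℕ, Matrix (Fin (a (j + 1))) (Fin (a j)) ℝ) →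
      Matrix (Fin (a J)) (Fin (a 0)) ℝ
  | 0, _ => 1
  | J + 1, D => D J * chainProd a J D

/-- Minimal cardinality of an `ε`-net of `D` with respect to the Frobenius metric. -/
noncomputable def coveringNumber {p q : ℕ} (D : Set (Matrix (Fin p) (Fin q) ℝ))
    (ε : ℝ) : ℕ :=
  sInf {n : ℕ | ∃ F : Finset (Matrix (Fin p) (Fin q) ℝ), F.card = n ∧
    ∀ M ∈ D, ∃ B ∈ F, frobNorm (M - B) ≤ ε}

section Frobenius

attribute [local instance] Matrix.frobeniusNormedAddCommGroup

theorem frobNorm_eq_norm {p q : ℕ} (A : Matrix (Fin p) (Fin q) ℝ) : frobNorm A = ‖A‖ := by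
  rw [Matrix.frobenius_norm_def, frobNorm, Real.sqrt_eq_rpow]
  simp

theorem frobNorm_nonneg {p q : ℕ} (A : Matrix (Fin p) (Fin q) ℝ) : 0 ≤ frobNorm A :=
  Real.sqrt_nonneg _

theorem frobNorm_add_le {p q : ℕ} (A B : Matrix (Fin p) (Fin q) ℝ) :
    frobNorm (A + B) ≤ frobNorm A + frobNorm B := by
  simpa only [frobNorm_eq_norm] using norm_add_le A B

theorem frobNorm_sub_le {p q : ℕ} (A B : Matrix (Fin p) (Fin q) ℝ) :
    frobNorm (A - B) ≤ frobNorm A + frobNorm B := by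
  simpa only [frobNorm_eq_norm] using norm_sub_le A B

theorem frobNorm_mul_le {p q r : ℕ} (A : Matrix (Fin p) (Fin q) ℝ)
    (B : Matrix (Fin q) (Fin r) ℝ) : frobNorm (A * B) ≤ frobNorm A * frobNorm B := by
  simpa only [frobNorm_eq_norm] using Matrix.frobenius_norm_mul A B

end Frobenius

theorem abs_apply_le_frobNorm {p q : ℕ} (A : Matrix (Fin p) (Fin q) ℝ) (i : Fin p)
    (j : Fin q) : |A i j| ≤ frobNorm A := by
  apply Real.abs_le_sqrt
  calc A i j ^ 2 ≤ ∑ j, A i j ^ 2 :=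
        Finset.single_le_sum (f := fun j => A i j ^ 2) (fun _ _ => sq_nonneg _)
          (Finset.mem_univ j)
    _ ≤ _ := Finset.single_le_sum (f := fun i => ∑ j, A i j ^ 2)
          (fun _ _ => Finset.sum_nonneg fun _ _ => sq_nonneg _) (Finset.mem_univ i)

theorem frobNorm_le_of_abs_apply_le {p q : ℕ} {A : Matrix (Fin p) (Fin q) ℝ} {δ : ℝ}
    (hδ : 0 ≤ δ) (h : ∀ i j, |A i j| ≤ δ) : frobNorm A ≤ (p * q + 1) * δ := by
  apply Real.sqrt_le_iff.2 ⟨by positivity, ?_⟩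
  calc ∑ i, ∑ j, A i j ^ 2 ≤ ∑ _i : Fin p, ∑ _j : Fin q, δ ^ 2 :=
        Finset.sum_le_sum fun i _ => Finset.sum_le_sum fun j _ =>
          sq_le_sq' (abs_le.1 (h i j)).1 (abs_le.1 (h i j)).2
    _ = (p * q) * δ ^ 2 := by simp; ring
    _ ≤ ((p * q + 1) * δ) ^ 2 := by
        rw [mul_pow]
        have : (0 : ℝ) ≤ p * q := by positivity
        gcongr
        nlinarith

/-- A `δ`-net of the interval `[-1, 1]` made of multiples of `δ`. -/
theorem exists_net_interval {δ : ℝ} (hδ : 0 < δ) (hδ1 : δ ≤ 1) :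
    ∃ G : Finset ℝ, (G.card : ℝ) ≤ 5 / δ ∧ ∀ x : ℝ, |x| ≤ 1 → ∃ y ∈ G, |x - y| ≤ δ := by
  refine ⟨(Finset.Icc (-(⌈1 / δ⌉₊ : ℤ)) ⌈1 / δ⌉₊).image fun k : ℤ => (k : ℝ) * δ, ?_, ?_⟩
  · have hcard : ((Finset.Icc (-(⌈1 / δ⌉₊ : ℤ)) ⌈1 / δ⌉₊).card : ℝ) = 2 * ⌈1 / δ⌉₊ + 1 := by
      rw [Int.card_Icc]
      have : ((⌈1 / δ⌉₊ : ℤ) + 1 - -(⌈1 / δ⌉₊ : ℤ)).toNat = 2 * ⌈1 / δ⌉₊ + 1 := by omega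
      rw [this]
      push_cast
      ring
    have hceil := Nat.ceil_lt_add_one (a := 1 / δ) (by positivity)
    have hone : 1 ≤ 1 / δ := (one_le_div hδ).2 hδ1
    have hle : ((((Finset.Icc (-(⌈1 / δ⌉₊ : ℤ)) ⌈1 / δ⌉₊).image
        fun k : ℤ => (k : ℝ) * δ).card : ℕ) : ℝ) ≤ 2 * ⌈1 / δ⌉₊ + 1 := by
      rw [← hcard]
      exact_mod_cast Finset.card_image_le
    calc _ ≤ _ := hle
      _ ≤ 5 * (1 / δ) := by linarith
      _ = 5 / δ := by ring
  · intro x hx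
    obtain ⟨hx1, hx2⟩ := abs_le.1 hx
    have hceil := Nat.le_ceil (1 / δ)
    refine ⟨⌊x / δ⌋ * δ, Finset.mem_image.2 ⟨⌊x / δ⌋, Finset.mem_Icc.2 ⟨?_, ?_⟩, rfl⟩, ?_⟩
    · rw [Int.le_floor]
      push_cast
      have : -(1 / δ) ≤ x / δ := by
        rw [← neg_div]
        gcongr
      linarith
    · have h1 : x / δ ≤ 1 / δ := by gcongr
      have h2 := Int.floor_le (x / δ)
      exact_mod_cast (show ((⌊x / δ⌋ : ℤ) : ℝ) ≤ (⌈1 / δ⌉₊ : ℝ) by linarith)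
    · have h1 := (le_div_iff₀ hδ).1 (Int.floor_le (x / δ))
      have h2 := (div_lt_iff₀ hδ).1 (Int.lt_floor_add_one (x / δ))
      rw [abs_le]
      constructor <;> linarith

theorem exists_net_sparse (p q s : ℕ) (hs : 0 < s) :
    ∃ C : ℝ, 0 < C ∧ ∀ ε : ℝ, 0 < ε → ε ≤ 1 →
      ∃ F : Finset (Matrix (Fin p) (Fin q) ℝ), (F.card : ℝ) ≤ (C / ε) ^ s ∧
        ∀ A : Matrix (Fin p) (Fin q) ℝ, l0 A ≤ s → frobNorm A ≤ 1 →
          ∃ B ∈ F, frobNorm (A - B) ≤ ε := by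
  classical
  refine ⟨2 ^ (p * q) * (5 * (p * q + 1)), by positivity, fun ε hε hε1 => ?_⟩
  have hK : (1 : ℝ) ≤ p * q + 1 := by
    have : (0 : ℝ) ≤ p * q := by positivity
    linarith
  obtain ⟨G, hGcard, hG⟩ := exists_net_interval (δ := ε / (p * q + 1)) (by positivity)
    ((div_le_one (by positivity)).2 (hε1.trans hK))
  let T (S : Finset (Fin p × Fin q)) : Finset (Matrix (Fin p) (Fin q) ℝ) :=
    (Fintype.piFinset fun ij => if ij ∈ S then G else {0}).image
      fun g => Matrix.of fun i j => g (i, j)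
  have hGne : 1 ≤ G.card := by
    obtain ⟨y, hy, -⟩ := hG 0 (by simp)
    exact Finset.card_pos.2 ⟨y, hy⟩
  have hT (S : Finset (Fin p × Fin q)) (hS : S.card ≤ s) : (T S).card ≤ G.card ^ s := by
    calc (T S).card ≤ _ := Finset.card_image_le
      _ = ∏ ij, (if ij ∈ S then G.card else 1) := by
        rw [Fintype.card_piFinset]
        refine Finset.prod_congr rfl fun ij _ => ?_
        split_ifs <;> simp
      _ = G.card ^ S.card := by simp [Finset.prod_ite_mem]
      _ ≤ G.card ^ s := Nat.pow_le_pow_right hGne hS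
  refine ⟨(Finset.univ.filter fun S : Finset (Fin p × Fin q) => S.card ≤ s).biUnion T, ?_, ?_⟩
  · have hcard : ((Finset.univ.filter fun S : Finset (Fin p × Fin q) => S.card ≤ s).biUnion
        T).card ≤ 2 ^ (p * q) * G.card ^ s := by
      refine (Finset.card_biUnion_le_card_mul _ _ (G.card ^ s) fun S hS =>
        hT S (Finset.mem_filter.1 hS).2).trans ?_
      gcongr
      refine (Finset.card_filter_le _ _).trans ?_
      simp
    calc _ ≤ ((2 ^ (p * q) * G.card ^ s : ℕ) : ℝ) := by exact_mod_cast hcard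
      _ = 2 ^ (p * q) * (G.card : ℝ) ^ s := by push_cast; rfl
      _ ≤ (2 ^ (p * q)) ^ s * (5 / (ε / (p * q + 1))) ^ s := by
        gcongr
        exact le_self_pow₀ (one_le_pow₀ one_le_two) hs.ne'
      _ = _ := by
        rw [← mul_pow]
        congr 1
        field_simp
  · intro A hA0 hA1
    choose! r hrG hr using hG
    have habs (i j) : |A i j| ≤ 1 := (abs_apply_le_frobNorm A i j).trans hA1
    refine ⟨Matrix.of fun i j => if A i j ≠ 0 then r (A i j) else 0,
      Finset.mem_biUnion.2 ⟨Finset.univ.filter fun ij => A ij.1 ij.2 ≠ 0, ?_, ?_⟩, ?_⟩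
    · refine Finset.mem_filter.2 ⟨Finset.mem_univ _, le_trans (le_of_eq ?_) hA0⟩
      unfold l0
      congr
    · refine Finset.mem_image.2 ⟨fun ij => if A ij.1 ij.2 ≠ 0 then r (A ij.1 ij.2) else 0,
        Fintype.mem_piFinset.2 fun ij => ?_, rfl⟩
      by_cases h : A ij.1 ij.2 = 0
      · simp [h]
      · simpa [h] using hrG _ (habs ij.1 ij.2)
    · calc _ ≤ ((p * q + 1) * (ε / (p * q + 1)) : ℝ) := by
            refine frobNorm_le_of_abs_apply_le (by positivity) fun i j => ?_
            by_cases h : A i j = 0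
            · simp only [Matrix.sub_apply, Matrix.of_apply, h, ne_eq, not_true_eq_false,
                if_false, sub_zero, abs_zero]
              positivity
            · simpa [h] using hr _ (habs i j)
        _ = ε := by field_simp

theorem frobNorm_chainProd_le (a : ℕ → ℕ) (D : ∀ j : ℕ, Matrix (Fin (a (j + 1))) (Fin (a j)) ℝ)
    (J : ℕ) (hD : ∀ j < J, frobNorm (D j) ≤ 1) :
    frobNorm (chainProd a J D) ≤ frobNorm (1 : Matrix (Fin (a 0)) (Fin (a 0)) ℝ) := by
  induction J with
  | zero => exact le_rfl
  | succ J ih =>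
    calc frobNorm (D J * chainProd a J D) ≤ frobNorm (D J) * frobNorm (chainProd a J D) :=
          frobNorm_mul_le _ _
      _ ≤ 1 * frobNorm (chainProd a J D) :=
          mul_le_mul_of_nonneg_right (hD J J.lt_succ_self) (frobNorm_nonneg _)
      _ ≤ _ := by
          rw [one_mul]
          exact ih fun j hj => hD j (hj.trans J.lt_succ_self)

theorem frobNorm_mul_sub_mul_le {p q r : ℕ} (A A' : Matrix (Fin p) (Fin q) ℝ)
    (B B' : Matrix (Fin q) (Fin r) ℝ) :
    frobNorm (A * B - A' * B') ≤ frobNorm (A - A') * frobNorm B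
      + frobNorm A * frobNorm (B - B') + frobNorm (A - A') * frobNorm (B - B') := by
  have : A * B - A' * B' = (A - A') * B + A * (B - B') - (A - A') * (B - B') := by
    simp only [Matrix.sub_mul, Matrix.mul_sub]
    abel
  rw [this]
  refine (frobNorm_sub_le _ _).trans (add_le_add ((frobNorm_add_le _ _).trans
    (add_le_add ?_ ?_)) ?_) <;> exact frobNorm_mul_le _ _

theorem exists_net_chainProd (a s : ℕ → ℕ) (J : ℕ) (hs : ∀ j < J, 0 < s j) :
    ∃ C : ℝ, 0 < C ∧ ∀ ε : ℝ, 0 < ε → ε ≤ 1 →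
      ∃ F : Finset (Matrix (Fin (a J)) (Fin (a 0)) ℝ),
        (F.card : ℝ) ≤ (C / ε) ^ (∑ j ∈ Finset.range J, s j) ∧
        ∀ D : ∀ j : ℕ, Matrix (Fin (a (j + 1))) (Fin (a j)) ℝ,
          (∀ j < J, l0 (D j) ≤ s j ∧ frobNorm (D j) ≤ 1) →
          ∃ B ∈ F, frobNorm (chainProd a J D - B) ≤ ε := by
  classical
  induction J with
  | zero =>
    refine ⟨1, one_pos, fun ε hε _ => ⟨{1}, by simp, fun D _ => ⟨1, by simp, ?_⟩⟩⟩
    simpa [chainProd, frobNorm] using hε.le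
  | succ J ih =>
    obtain ⟨C₁, hC₁, h₁⟩ := ih fun j hj => hs j (hj.trans J.lt_succ_self)
    obtain ⟨C₂, hC₂, h₂⟩ := exists_net_sparse (a (J + 1)) (a J) (s J) (hs J J.lt_succ_self)
    set K := frobNorm (1 : Matrix (Fin (a 0)) (Fin (a 0)) ℝ) with hKdef
    have hK : 0 ≤ K := frobNorm_nonneg _
    refine ⟨max (3 * C₁) (3 * (K + 1) * C₂), by positivity, fun ε hε hε1 => ?_⟩
    obtain ⟨F₁, hF₁, hN₁⟩ := h₁ (ε / 3) (by positivity) (by linarith)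
    obtain ⟨F₂, hF₂, hN₂⟩ := h₂ (ε / (3 * (K + 1))) (by positivity)
      ((div_le_one (by positivity)).2 (by linarith))
    refine ⟨Finset.image₂ (fun A B => A * B) F₂ F₁, ?_, fun D hD => ?_⟩
    · calc ((Finset.image₂ (fun A B => A * B) F₂ F₁).card : ℝ) ≤ (F₁.card : ℝ) * F₂.card := by
            rw [mul_comm]
            exact_mod_cast Finset.card_image₂_le (fun A B => A * B) F₂ F₁
        _ ≤ (C₁ / (ε / 3)) ^ (∑ j ∈ Finset.range J, s j) *
              (C₂ / (ε / (3 * (K + 1)))) ^ s J := by gcongr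
        _ = (3 * C₁ / ε) ^ (∑ j ∈ Finset.range J, s j) * (3 * (K + 1) * C₂ / ε) ^ s J := by
            congr 2 <;> field_simp
        _ ≤ _ := by
            rw [Finset.sum_range_succ, pow_add]
            gcongr
            · exact le_max_left _ _
            · exact le_max_right _ _
    · obtain ⟨P, hP, hPe⟩ := hN₁ D fun j hj => hD j (hj.trans J.lt_succ_self)
      obtain ⟨A, hA, hAe⟩ := hN₂ (D J) (hD J J.lt_succ_self).1 (hD J J.lt_succ_self).2
      refine ⟨A * P, Finset.mem_image₂_of_mem hA hP, ?_⟩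
      have hprod := frobNorm_chainProd_le a D J fun j hj => (hD j (hj.trans J.lt_succ_self)).2
      rw [← hKdef] at hprod
      have hδ : ε / (3 * (K + 1)) * (K + 1) = ε / 3 := by field_simp
      have hδ0 : 0 < ε / (3 * (K + 1)) := by positivity
      calc frobNorm (D J * chainProd a J D - A * P) ≤ _ := frobNorm_mul_sub_mul_le _ _ _ _
        _ ≤ ε / (3 * (K + 1)) * K + 1 * (ε / 3) + ε / (3 * (K + 1)) * (ε / 3) := by
            gcongr
            all_goals first | exact frobNorm_nonneg _ | exact (hD J J.lt_succ_self).2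
        _ ≤ ε := by nlinarith

theorem limsup_log_coveringNumber_le {p q n : ℕ} {S : Set (Matrix (Fin p) (Fin q) ℝ)} {C : ℝ}
    (h : ∀ ε : ℝ, 0 < ε → ε ≤ 1 → ∃ F : Finset (Matrix (Fin p) (Fin q) ℝ),
      (F.card : ℝ) ≤ (C / ε) ^ n ∧ ∀ M ∈ S, ∃ B ∈ F, frobNorm (M - B) ≤ ε) (hC : 0 < C) :
    Filter.limsup (fun ε : ℝ => Real.log (coveringNumber S ε) / Real.log (1 / ε))
      (nhdsWithin 0 (Set.Ioi (0 : ℝ))) ≤ (n : ℝ) := by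
  have hlog : Filter.Tendsto (fun ε : ℝ => Real.log (1 / ε)) (nhdsWithin 0 (Set.Ioi 0))
      Filter.atTop := by
    simp only [one_div, Real.log_inv]
    exact Filter.tendsto_neg_atBot_atTop.comp Real.tendsto_log_nhdsGT_zero
  have hlim : Filter.Tendsto (fun ε : ℝ => n * (Real.log (max C 1) / Real.log (1 / ε) + 1))
      (nhdsWithin 0 (Set.Ioi 0)) (nhds (n : ℝ)) := by
    simpa using ((hlog.const_div_atTop (Real.log (max C 1))).add_const 1).const_mul (n : ℝ)
  have hev : ∀ᶠ ε : ℝ in nhdsWithin 0 (Set.Ioi 0), 0 < ε ∧ ε < 1 :=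
    Ioo_mem_nhdsGT one_pos
  rw [← hlim.limsup_eq]
  refine Filter.limsup_le_limsup ?_ ?_ hlim.isBoundedUnder_le
  · filter_upwards [hev] with ε hε
    obtain ⟨F, hF, hnet⟩ := h ε hε.1 hε.2.le
    have hpos : 0 < Real.log (1 / ε) := Real.log_pos ((one_lt_div hε.1).2 hε.2)
    have hcov : coveringNumber S ε ≤ F.card := Nat.sInf_le ⟨F, rfl, hnet⟩
    have hmax : 1 ≤ max C 1 / ε :=
      (one_le_div hε.1).2 (hε.2.le.trans (le_max_right _ _))
    have hle : (coveringNumber S ε : ℝ) ≤ (max C 1 / ε) ^ n :=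
      calc (coveringNumber S ε : ℝ) ≤ F.card := by exact_mod_cast hcov
        _ ≤ (C / ε) ^ n := hF
        _ ≤ _ := by
          have := hε.1
          gcongr
          exact le_max_left _ _
    have hlogle : Real.log (coveringNumber S ε) ≤ n * Real.log (max C 1 / ε) := by
      rcases Nat.eq_zero_or_pos (coveringNumber S ε) with h0 | h0
      · rw [h0, Nat.cast_zero, Real.log_zero]
        exact mul_nonneg n.cast_nonneg (Real.log_nonneg hmax)
      · rw [← Real.log_pow]
        exact Real.log_le_log (by exact_mod_cast h0) hle
    have hsplit : Real.log (max C 1 / ε) = Real.log (max C 1) + Real.log (1 / ε) := by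
      rw [← Real.log_mul (by positivity) (by have := hε.1; positivity), mul_one_div]
    rw [div_le_iff₀ hpos]
    calc _ ≤ _ := hlogle
      _ = _ := by
        rw [hsplit]
        field_simp
  · refine Filter.IsBoundedUnder.isCoboundedUnder_le ⟨0, Filter.eventually_map.2 ?_⟩
    filter_upwards [hev] with ε hε
    exact div_nonneg (Real.log_natCast_nonneg _)
      (Real.log_nonneg ((one_le_div hε.1).2 hε.2.le))

/-- The set of products of `J` sparse unit-Frobenius-norm factors admits, for some `C > 0`
and every `ε ∈ (0,1]`, an `ε`-net of cardinality at most `(C/ε)^{s_tot}`; consequently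
its upper box-counting dimension is at most `s_tot = Σ_j s_j`. -/
theorem covering_dimension_multilayer_sparse_products
    (J : ℕ) (hJ : 1 ≤ J) (a : ℕ → ℕ) (ha : ∀ j, 0 < a j)
    (s : ℕ → ℕ) (hs : ∀ j < J, 0 < s j ∧ s j ≤ a j * a (j + 1))
    (stot : ℕ) (hstot : stot = ∑ j ∈ Finset.range J, s j)
    (Dset : Set (Matrix (Fin (a J)) (Fin (a 0)) ℝ))
    (hDset : Dset = {M | ∃ D : ∀ j : ℕ, Matrix (Fin (a (j + 1))) (Fin (a j)) ℝ,
      (∀ j < J, l0 (D j) ≤ s j ∧ frobNorm (D j) = 1) ∧ M = chainProd a J D}) :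
    (∃ C : ℝ, 0 < C ∧ ∀ ε : ℝ, 0 < ε → ε ≤ 1 →
      ∃ F : Finset (Matrix (Fin (a J)) (Fin (a 0)) ℝ),
        (F.card : ℝ) ≤ (C / ε) ^ stot ∧
        ∀ M ∈ Dset, ∃ B ∈ F, frobNorm (M - B) ≤ ε) ∧
    Filter.limsup
        (fun ε : ℝ => Real.log (coveringNumber Dset ε) / Real.log (1 / ε))
        (nhdsWithin 0 (Set.Ioi (0 : ℝ))) ≤ (stot : ℝ) := by
  subst hstot hDset
  obtain ⟨C, hC, hnet⟩ := exists_net_chainProd a s J fun j hj => (hs j hj).1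
  have key : ∀ ε : ℝ, 0 < ε → ε ≤ 1 → ∃ F : Finset (Matrix (Fin (a J)) (Fin (a 0)) ℝ),
      (F.card : ℝ) ≤ (C / ε) ^ (∑ j ∈ Finset.range J, s j) ∧
      ∀ M ∈ {M | ∃ D : ∀ j : ℕ, Matrix (Fin (a (j + 1))) (Fin (a j)) ℝ,
        (∀ j < J, l0 (D j) ≤ s j ∧ frobNorm (D j) = 1) ∧ M = chainProd a J D},
      ∃ B ∈ F, frobNorm (M - B) ≤ ε := by
    intro ε hε hε1
    obtain ⟨F, hF, hD⟩ := hnet ε hε hε1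
    refine ⟨F, hF, ?_⟩
    rintro _ ⟨D, hDj, rfl⟩
    exact hD D fun j hj => ⟨(hDj j hj).1, (hDj j hj).2.le⟩
  exact ⟨⟨C, hC, key⟩, limsup_log_coveringNumber_le key hC⟩
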